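/- arXiv:2105.12185 — 3 statements merged into one kernel-verified Lean document; each statement's English description precedes it below -/
import Mathlib

section
/- For any linear orders α and β, there is an isomorphism of L_⊗-structures MSO(α) ⊗ MSO(β) ≅ MSO(α + β), where α + β is the ordered sum of α and β (every element of α placed below every element of β). -/
open FirstOrder FirstOrder.Language

namespace MSO

/-! ### The language `L_⊗` and its semantics -/

/-- The language `L_⊗`: a constant `⊥`, a unary relation `At`,
and two binary relations: `⊆` (encoded `true`) and `≤ᴱ` (encoded `false`). -/
def Lmso : Language where
  Functions := fun n => match n with | 0 => Unit | _ => Empty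
  Relations := fun n => match n with | 1 => Unit | 2 => Bool | _ => Empty

/-- The constant symbol `⊥`. -/
def botC : Lmso.Constants := Unit.unit
/-- The unary relation symbol `At`. -/
def atR : Lmso.Relations 1 := Unit.unit
/-- The binary relation symbol `⊆`. -/
def subR : Lmso.Relations 2 := true
/-- The binary relation symbol `≤ᴱ`. -/
def exleR : Lmso.Relations 2 := false

/-- The interpretation of `⊥` in an `L_⊗`-structure. -/
def botE (M : Type*) [Lmso.Structure M] : M := Structure.funMap botC ![]
/-- The interpretation of `At` in an `L_⊗`-structure. -/
def atE {M : Type*} [Lmso.Structure M] (a : M) : Prop := Structure.RelMap atR ![a]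
/-- The interpretation of `⊆` in an `L_⊗`-structure. -/
def subE {M : Type*} [Lmso.Structure M] (a b : M) : Prop := Structure.RelMap subR ![a, b]
/-- The interpretation of `≤ᴱ` in an `L_⊗`-structure. -/
def exleE {M : Type*} [Lmso.Structure M] (a b : M) : Prop := Structure.RelMap exleR ![a, b]

/-- The monadic second order version `M̃SO(α)` of a linear order `α`, as an `L_⊗`-structure:
the universe is the powerset of `α`, `⊆` is inclusion, `⊥` is `∅`, `At` holds of singletons,
and `A ≤ᴱ B` iff there are `a ∈ A` and `b ∈ B` with `a < b`. -/
instance msoStructure (α : Type*) [LinearOrder α] : Lmso.Structure (Set α) where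
  funMap := fun {n} f _ => match n, f with
    | 0, _ => (∅ : Set α)
  RelMap := fun {n} r v => match n, r with
    | 1, _ => ∃ a : α, v 0 = {a}
    | 2, true => v 0 ⊆ v 1
    | 2, false => ∃ a ∈ v 0, ∃ b ∈ v 1, a < b

/-- `MSO(n)`, the monadic second order version of the `n`-element linear order. -/
abbrev MSOn (n : ℕ) : Type := Set (Fin n)

/-- The operation `⊗` on `L_⊗`-structures: the universe is the product, `⊆` is componentwise,
`⊥` is the pair of bottoms, `At` holds of the atoms (minimal non-bottom elements) of the
resulting order, and `(A,B) ≤ᴱ (C,D)` iff (`A ≠ ⊥` and `D ≠ ⊥`), or `A ≤ᴱ C`, or `B ≤ᴱ D`. -/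
instance tensorStructure (M N : Type*) [Lmso.Structure M] [Lmso.Structure N] :
    Lmso.Structure (M × N) where
  funMap := fun {n} f _ => match n, f with
    | 0, _ => (botE M, botE N)
  RelMap := fun {n} r v => match n, r with
    | 1, _ => v 0 ≠ (botE M, botE N) ∧
        ∀ q : M × N, subE q.1 (v 0).1 → subE q.2 (v 0).2 →
          q = (botE M, botE N) ∨ q = v 0
    | 2, true => subE (v 0).1 (v 1).1 ∧ subE (v 0).2 (v 1).2
    | 2, false => ((v 0).1 ≠ botE M ∧ (v 1).2 ≠ botE N) ∨
        exleE (v 0).1 (v 1).1 ∨ exleE (v 0).2 (v 1).2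

/-! ### Formulas -/

/-- Bounded `L_⊗`-formulas with no free (outer) variables. -/
abbrev BF (n : ℕ) := Lmso.BoundedFormula Empty n

/-- The `i`-th de Bruijn variable as a term. -/
def tv {n : ℕ} (i : Fin n) : Lmso.Term (Empty ⊕ Fin n) := Term.var (Sum.inr i)
/-- The constant `⊥` as a term. -/
def tb {n : ℕ} : Lmso.Term (Empty ⊕ Fin n) := Constants.term botC

def sub' {n : ℕ} (i j : Fin n) : BF n := subR.boundedFormula₂ (tv i) (tv j)
def exle' {n : ℕ} (i j : Fin n) : BF n := exleR.boundedFormula₂ (tv i) (tv j)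
def at' {n : ℕ} (i : Fin n) : BF n := atR.boundedFormula₁ (tv i)
def eq' {n : ℕ} (i j : Fin n) : BF n := Term.bdEqual (tv i) (tv j)
def isBot' {n : ℕ} (i : Fin n) : BF n := Term.bdEqual (tv i) tb
def botSub' {n : ℕ} (i : Fin n) : BF n := subR.boundedFormula₂ tb (tv i)

/-- Finite conjunction. -/
def bigAnd {n : ℕ} (l : List (BF n)) : BF n := l.foldr (· ⊓ ·) ⊤
/-- Finite disjunction. -/
def bigOr {n : ℕ} (l : List (BF n)) : BF n := l.foldr (· ⊔ ·) ⊥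

/-- `k` is the meet of `i` and `j` (with respect to `⊆`). -/
def isMeet {n : ℕ} (k i j : Fin n) : BF n :=
  sub' k i ⊓ sub' k j ⊓
    ∀' ((sub' (Fin.last n) i.castSucc ⊓ sub' (Fin.last n) j.castSucc) ⟹
      sub' (Fin.last n) k.castSucc)

/-- `k` is the join of `i` and `j` (with respect to `⊆`). -/
def isJoin {n : ℕ} (k i j : Fin n) : BF n :=
  sub' i k ⊓ sub' j k ⊓
    ∀' ((sub' i.castSucc (Fin.last n) ⊓ sub' j.castSucc (Fin.last n)) ⟹
      sub' k.castSucc (Fin.last n))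

/-- The meet of `i` and `j` is `⊥`. -/
def meetIsBot {n : ℕ} (i j : Fin n) : BF n :=
  ∀' ((sub' (Fin.last n) i.castSucc ⊓ sub' (Fin.last n) j.castSucc) ⟹ isBot' (Fin.last n))

/-- The join of `i` and `j` is the top element. -/
def joinIsTop {n : ℕ} (i j : Fin n) : BF n :=
  ∀' ((sub' i.castSucc (Fin.last n) ⊓ sub' j.castSucc (Fin.last n)) ⟹
    ∀' (sub' (Fin.last (n + 1)) ((Fin.last n).castSucc)))

/-- `j` is a (Boolean) complement of `i`. -/
def isComplOf {n : ℕ} (j i : Fin n) : BF n := meetIsBot i j ⊓ joinIsTop i j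

/-- `i` is an atom: non-bottom, and minimal among non-bottom elements. -/
def isAtomDef {n : ℕ} (i : Fin n) : BF n :=
  ∼(isBot' i) ⊓
    ∀' (sub' (Fin.last n) i.castSucc ⟹ (isBot' (Fin.last n) ⊔ eq' (Fin.last n) i.castSucc))

/-! ### The base theory `T_base` -/

def axRefl : Lmso.Sentence := ∀' sub' 0 0
def axAntisymm : Lmso.Sentence := ∀' ∀' ((sub' 0 1 ⊓ sub' 1 0) ⟹ eq' 0 1)
def axTrans : Lmso.Sentence := ∀' ∀' ∀' ((sub' 0 1 ⊓ sub' 1 2) ⟹ sub' 0 2)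
def axBotLe : Lmso.Sentence := ∀' botSub' 0
def axTop : Lmso.Sentence := ∃' ∀' (sub' 1 0)
def axMeet : Lmso.Sentence := ∀' ∀' ∃' (isMeet 2 0 1)
def axJoin : Lmso.Sentence := ∀' ∀' ∃' (isJoin 2 0 1)
def axCompl : Lmso.Sentence := ∀' ∃' (isComplOf 1 0)
def axDistrib : Lmso.Sentence :=
  ∀' ∀' ∀' ∀' ∀' ∀' ∀' ∀'
    ((isMeet 3 0 1 ⊓ isMeet 4 0 2 ⊓ isJoin 5 1 2 ⊓ isMeet 6 0 5 ⊓ isJoin 7 3 4) ⟹ sub' 6 7)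
def axAt : Lmso.Sentence := ∀' (at' 0 ⇔ isAtomDef 0)
def axAtomic : Lmso.Sentence := ∀' (∼(isBot' 0) ⟹ ∃' (at' 1 ⊓ sub' 1 0))
def axIrrefl : Lmso.Sentence := ∀' (at' 0 ⟹ ∼(exle' 0 0))
def axTransAt : Lmso.Sentence :=
  ∀' ∀' ∀' ((at' 0 ⊓ at' 1 ⊓ at' 2 ⊓ exle' 0 1 ⊓ exle' 1 2) ⟹ exle' 0 2)
def axTrich : Lmso.Sentence :=
  ∀' ∀' ((at' 0 ⊓ at' 1) ⟹ (exle' 0 1 ⊔ eq' 0 1 ⊔ exle' 1 0))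
def axExleDef : Lmso.Sentence :=
  ∀' ∀' (exle' 0 1 ⇔ ∃' ∃' (at' 2 ⊓ at' 3 ⊓ sub' 2 0 ⊓ sub' 3 1 ⊓ exle' 2 3))

/-- The comprehension axiom for a formula `η(x; Y₁,…,Yₙ)` (with `x` the last variable):
`∀ Ȳ ∃ X ∀ x (At x → (x ⊆ X ↔ η(x; Ȳ)))`. -/
def compAx {n : ℕ} (η : BF (n + 1)) : Lmso.Sentence :=
  BoundedFormula.alls (∃' ∀' (at' (Fin.last (n + 1)) ⟹
    (sub' (Fin.last (n + 1)) ((Fin.last n).castSucc) ⇔ η.liftAt 1 n)))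

/-- The base theory `T_base`: an atomic Boolean algebra under `⊆` with bottom `⊥`, `At`
holding exactly of the atoms, `≤ᴱ` linearly ordering the atoms and determined by its
restriction to the atoms, together with the comprehension scheme. -/
def Tbase : Lmso.Theory :=
  {axRefl, axAntisymm, axTrans, axBotLe, axTop, axMeet, axJoin, axCompl, axDistrib,
    axAt, axAtomic, axIrrefl, axTransAt, axTrich, axExleDef} ∪
  ⋃ n : ℕ, Set.range (compAx (n := n))

/-! ### The theory `T_MSO(Fin)` -/

/-- `i` is the `≤ᴱ`-least atom. -/
def isLeastAtom {n : ℕ} (i : Fin n) : BF n :=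
  at' i ⊓ ∀' (at' (Fin.last n) ⟹ ∼(exle' (Fin.last n) i.castSucc))

/-- `i` is the `≤ᴱ`-greatest atom. -/
def isGreatestAtom {n : ℕ} (i : Fin n) : BF n :=
  at' i ⊓ ∀' (at' (Fin.last n) ⟹ ∼(exle' i.castSucc (Fin.last n)))

/-- `j` is the immediate `≤ᴱ`-successor of the atom `i`. -/
def isSuccOf {n : ℕ} (j i : Fin n) : BF n :=
  at' i ⊓ at' j ⊓ exle' i j ⊓
    ∀' ((at' (Fin.last n) ⊓ exle' i.castSucc (Fin.last n)) ⟹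
      (eq' (Fin.last n) j.castSucc ⊔ exle' j.castSucc (Fin.last n)))

def axLeastAtom : Lmso.Sentence := (∃' at' 0) ⟹ ∃' isLeastAtom 0
def axGreatestAtom : Lmso.Sentence := (∃' at' 0) ⟹ ∃' isGreatestAtom 0
def axSucc : Lmso.Sentence :=
  ∀' ((at' 0 ⊓ ∃' (at' 1 ⊓ exle' 0 1)) ⟹ ∃' isSuccOf 1 0)
def axPred : Lmso.Sentence :=
  ∀' ((at' 0 ⊓ ∃' (at' 1 ⊓ exle' 1 0)) ⟹ ∃' isSuccOf 0 1)
def axLeastIn : Lmso.Sentence :=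
  ∀' (∼(isBot' 0) ⟹ ∃' (at' 1 ⊓ sub' 1 0 ⊓ ∀' ((at' 2 ⊓ sub' 2 0) ⟹ ∼(exle' 2 1))))

/-- The theory `T_MSO(Fin)`: `T_base` together with axioms saying that the ordering of the
atoms is discrete with endpoints, and every non-bottom element contains a least atom. -/
def TMSOFin : Lmso.Theory :=
  Tbase ∪ {axLeastAtom, axGreatestAtom, axSucc, axPred, axLeastIn}

/-! ### Quantifier rank, unnested formulas, and `≈ₖ` -/

/-- Quantifier rank of a bounded formula. -/
def qr : ∀ {n : ℕ}, BF n → ℕ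
  | _, BoundedFormula.falsum => 0
  | _, BoundedFormula.equal _ _ => 0
  | _, BoundedFormula.rel _ _ => 0
  | _, BoundedFormula.imp f g => max (qr f) (qr g)
  | _, BoundedFormula.all f => qr f + 1

/-- A formula is unnested if every atomic subformula is of one of the forms
`x = y`, `c = y`, or `R x̄` with the `xᵢ`, `y` variables (Hodges). -/
def IsUnnested : ∀ {n : ℕ}, BF n → Prop
  | _, BoundedFormula.falsum => True
  | _, BoundedFormula.equal s t =>
      (∃ i j, s = Term.var i ∧ t = Term.var j) ∨
      (∃ (c : Lmso.Constants) (j : _), s = Constants.term c ∧ t = Term.var j)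
  | _, BoundedFormula.rel _ ts => ∀ i, ∃ j, ts i = Term.var j
  | _, BoundedFormula.imp f g => IsUnnested f ∧ IsUnnested g
  | _, BoundedFormula.all f => IsUnnested f

/-- `M ≈ₖ N` : `M` and `N` satisfy the same unnested `L_⊗`-sentences of quantifier
rank at most `k`. -/
def EquivK (k : ℕ) (M N : Type*) [Lmso.Structure M] [Lmso.Structure N] : Prop :=
  ∀ φ : Lmso.Sentence, IsUnnested φ → qr φ ≤ k → (M ⊨ φ ↔ N ⊨ φ)

/-! ### The sentences `ρ_{d,h}`, `ψ_{>n}`, `ψ_{=n}` -/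

/-- The index (in `Fin d`) of `A_h` among `A₁, …, A_d`, identifying `h = 0` with `h = d`. -/
def aIdx (d h : ℕ) (hd : 0 < d) : Fin d := ⟨(h + d - 1) % d, Nat.mod_lt _ hd⟩

/-- The cyclic successor on the indices `{1, …, d}`. -/
def cyc {d : ℕ} (j : Fin d) : Fin d := ⟨((j : ℕ) + 1) % d, Nat.mod_lt _ j.pos⟩

/-- The sentence `ρ_{d,h}`: there is a partition of the atoms into `d` non-bottom elements
`A₁, …, A_d` such that the least atom is in `A₁`, the immediate successor of an atom lying in
`A_j` lies in `A_{j+1}` (cyclically), and the greatest atom is in `A_h`. -/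
def rho (d h : ℕ) : Lmso.Sentence :=
  if hd : 0 < d then
    BoundedFormula.exs (n := d) (
      -- each `A_i` is non-bottom
      bigAnd ((List.finRange d).map fun i => ∼(isBot' i)) ⊓
      -- every atom lies in some `A_i`
      (∀' (at' (Fin.last d) ⟹
        bigOr ((List.finRange d).map fun i => sub' (Fin.last d) i.castSucc))) ⊓
      -- the `A_i` are pairwise disjoint on atoms
      bigAnd ((List.finRange d).flatMap fun i => (List.finRange d).filterMap fun j =>
        if i.val < j.val then
          some (∀' (at' (Fin.last d) ⟹
            ∼(sub' (Fin.last d) i.castSucc ⊓ sub' (Fin.last d) j.castSucc)))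
        else none) ⊓
      -- the least atom lies in `A₁`
      (∀' (isLeastAtom (Fin.last d) ⟹ sub' (Fin.last d) ((aIdx d 1 hd).castSucc))) ⊓
      -- immediate successors move cyclically through the `A_j`
      bigAnd ((List.finRange d).map fun j =>
        ∀' ∀' ((sub' ((Fin.last d).castSucc) (j.castSucc.castSucc) ⊓
            isSuccOf (Fin.last (d + 1)) ((Fin.last d).castSucc)) ⟹
          sub' (Fin.last (d + 1)) ((cyc j).castSucc.castSucc))) ⊓
      -- the greatest atom lies in `A_h`
      (∀' (isGreatestAtom (Fin.last d) ⟹ sub' (Fin.last d) ((aIdx d h hd).castSucc))))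
  else ⊥

/-- The list of formulas `xᵢ ≠ xⱼ` for `i < j < n`. -/
def distinctPairs (n : ℕ) : List (BF n) :=
  (List.finRange n).flatMap fun i => (List.finRange n).filterMap fun j =>
    if i.val < j.val then some (∼(eq' i j)) else none

/-- `ψ_{>n}` : there exist at least `n + 1` distinct atoms. -/
def psiGt (n : ℕ) : Lmso.Sentence :=
  BoundedFormula.exs (n := n + 1)
    (bigAnd ((List.finRange (n + 1)).map fun i => at' i) ⊓ bigAnd (distinctPairs (n + 1)))

/-- `ψ_{=n}` : there exist exactly `n` distinct atoms. -/
def psiEq (n : ℕ) : Lmso.Sentence :=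
  BoundedFormula.exs (n := n)
    (bigAnd ((List.finRange n).map fun i => at' i) ⊓ bigAnd (distinctPairs n) ⊓
      ∀' (at' (Fin.last n) ⟹ bigOr ((List.finRange n).map fun i => eq' (Fin.last n) i.castSucc)))

/-! ### Residue functions and the theories `T_r̃` -/

/-- A residue function `ℙ × ℕ_{>0} → ℕ` (conditions imposed only at primes `p` and `j ≥ 1`):
`r(p,j) < p^j` and `r(p,j+1) ≡ r(p,j) [MOD p^j]`. -/
def IsResidueFunction (r : ℕ → ℕ → ℕ) : Prop :=
  ∀ p j : ℕ, p.Prime → 1 ≤ j → r p j < p ^ j ∧ r p (j + 1) ≡ r p j [MOD p ^ j]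

/-- A function `ℕ_{>1} → ℕ` is a residue function if it arises from a residue function
`ℙ × ℕ_{>0} → ℕ` as in the paper (conditions imposed only for `d > 1`). -/
def IsResidueFunctionTilde (rt : ℕ → ℕ) : Prop :=
  ∃ r : ℕ → ℕ → ℕ, IsResidueFunction r ∧
    ∀ d : ℕ, 1 < d → rt d < d ∧
      ∀ p j : ℕ, p.Prime → 1 ≤ j → p ^ j ∣ d → rt d ≡ r p j [MOD p ^ j]

/-- The theory `T_r̃ = T_MSO(Fin) ∪ {ψ_{>n} : n ∈ ℕ} ∪ {ρ_{d,r̃(d)} : d > 1}`. -/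
def Trt (rt : ℕ → ℕ) : Lmso.Theory :=
  TMSOFin ∪ Set.range psiGt ∪ {σ : Lmso.Sentence | ∃ d : ℕ, 1 < d ∧ σ = rho d (rt d)}

/-! ### Relativization and the sum of sentences -/

/-- Relativization of a formula to the elements `⊆ v`:
each quantifier `∀ Z (…)` becomes `∀ Z (Z ⊆ v → …)`. -/
def relv : ∀ {n : ℕ}, BF n → Fin n → BF n
  | _, BoundedFormula.falsum, _ => BoundedFormula.falsum
  | _, BoundedFormula.equal s t, _ => BoundedFormula.equal s t
  | _, BoundedFormula.rel r ts, _ => BoundedFormula.rel r ts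
  | _, BoundedFormula.imp f g, v => (relv f v).imp (relv g v)
  | n, BoundedFormula.all f, v =>
      BoundedFormula.all (sub' (Fin.last n) v.castSucc ⟹ relv f v.castSucc)

/-- `i` is downward closed with respect to the `≤ᴱ`-ordering of the atoms. -/
def dwcl' {n : ℕ} (i : Fin n) : BF n :=
  ∀' ∀' ((at' ((Fin.last n).castSucc) ⊓ at' (Fin.last (n + 1)) ⊓
      sub' ((Fin.last n).castSucc) (i.castSucc.castSucc) ⊓
      exle' (Fin.last (n + 1)) ((Fin.last n).castSucc)) ⟹
    sub' (Fin.last (n + 1)) (i.castSucc.castSucc))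

/-- The sentence `φ + ψ` : `∃ X (X downward closed ∧ φ^X ∧ ψ^(Xᶜ))`
(with the complement `Xᶜ` introduced by an existential quantifier). -/
def plusSent (φ ψ : Lmso.Sentence) : Lmso.Sentence :=
  ∃' ∃' (dwcl' (0 : Fin 2) ⊓ isComplOf (1 : Fin 2) (0 : Fin 2) ⊓
    relv (φ.liftAt 2 0) (0 : Fin 2) ⊓ relv (ψ.liftAt 2 0) (1 : Fin 2))

/-! ### `FSpec` and ultimate periodicity -/

/-- `FSpec φ` : the set of `n ∈ ℕ` such that `MSO(n) ⊨ φ`. -/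
def FSpec (φ : Lmso.Sentence) : Set ℕ := {n : ℕ | MSOn n ⊨ φ}

/-- A set of naturals is ultimately periodic. -/
def UltPeriodic (S : Set ℕ) : Prop :=
  ∃ N d : ℕ, 0 < d ∧ ∀ n : ℕ, N < n → (n ∈ S ↔ n + d ∈ S)

/-! ### The language `L_MO = {⊆, <}` -/

/-- The language `L_MO` with two binary relations: `⊆` (encoded `true`) and `<`
(encoded `false`). -/
def Lmo : Language where
  Functions := fun _ => Empty
  Relations := fun n => match n with | 2 => Bool | _ => Empty

/-- The monadic second order version `MSO(α)` of a linear order `α` as an `L_MO`-structure: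
`⊆` is inclusion and `<` is the ordering of `α` on singletons. -/
instance moStructure (α : Type*) [LinearOrder α] : Lmo.Structure (Set α) where
  funMap := fun f _ => f.elim
  RelMap := fun {n} r v => match n, r with
    | 2, true => v 0 ⊆ v 1
    | 2, false => ∃ a b : α, v 0 = {a} ∧ v 1 = {b} ∧ a < b

/-! ### Subsets of an ordered sum -/

/-- A subset of `α + β` is a pair consisting of a subset of `α` and a subset of `β`. -/
def setProdOrderIso (α β : Type*) : Set α × Set β ≃o Set (Lex (α ⊕ β)) where
  toFun p := {x | Sum.elim (· ∈ p.1) (· ∈ p.2) (ofLex x)}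
  invFun S := ({a | toLex (Sum.inl a) ∈ S}, {b | toLex (Sum.inr b) ∈ S})
  left_inv _ := rfl
  right_inv S := by
    ext x
    obtain ⟨x | x, rfl⟩ := toLex.surjective x <;> rfl
  map_rel_iff' {p q} := by
    refine ⟨fun h => ⟨fun a ha => ?_, fun b hb => ?_⟩, fun h x => ?_⟩
    · exact @h (toLex (Sum.inl a)) ha
    · exact @h (toLex (Sum.inr b)) hb
    · obtain ⟨x | x, rfl⟩ := toLex.surjective x
      · exact fun hx => h.1 hx
      · exact fun hx => h.2 hx

theorem toLex_inl_mem_setProdOrderIso {α β : Type*} {p : Set α × Set β} {a : α} :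
    toLex (Sum.inl a) ∈ setProdOrderIso α β p ↔ a ∈ p.1 := Iff.rfl

theorem toLex_inr_mem_setProdOrderIso {α β : Type*} {p : Set α × Set β} {b : β} :
    toLex (Sum.inr b) ∈ setProdOrderIso α β p ↔ b ∈ p.2 := Iff.rfl

/-! ### The interpreted symbols in `MSO(α)` and in `M ⊗ N` -/

section Interpretation

variable {α β : Type*} [LinearOrder α] [LinearOrder β]

theorem atE_set {A : Set α} : atE A ↔ IsAtom A := Set.isAtom_iff.symm

theorem exleE_set {A B : Set α} : exleE A B ↔ ∃ a ∈ A, ∃ b ∈ B, a < b := Iff.rfl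

theorem atE_set_prod {p : Set α × Set β} : atE p ↔ IsAtom p := by
  change p ≠ ⊥ ∧ (∀ q : Set α × Set β, q.1 ≤ p.1 → q.2 ≤ p.2 → q = ⊥ ∨ q = p) ↔ _
  refine and_congr_right fun _ => ⟨fun h q hq => ?_, fun h q h₁ h₂ => ?_⟩
  · exact (h q hq.le.1 hq.le.2).resolve_right hq.ne
  · exact or_iff_not_imp_right.2 fun hne => h q (lt_of_le_of_ne ⟨h₁, h₂⟩ hne)

theorem exleE_set_prod {p q : Set α × Set β} :
    exleE p q ↔ (p.1.Nonempty ∧ q.2.Nonempty) ∨ exleE p.1 q.1 ∨ exleE p.2 q.2 := by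
  rw [Set.nonempty_iff_ne_empty, Set.nonempty_iff_ne_empty]
  rfl

theorem exleE_setProdOrderIso {p q : Set α × Set β} :
    exleE (setProdOrderIso α β p) (setProdOrderIso α β q) ↔ exleE p q := by
  simp only [exleE_set_prod, exleE_set, toLex.surjective.exists, Sum.exists,
    toLex_inl_mem_setProdOrderIso, toLex_inr_mem_setProdOrderIso, Sum.Lex.inl_lt_inl_iff,
    Sum.Lex.inr_lt_inr_iff, Sum.Lex.inl_lt_inr, Sum.Lex.not_inr_lt_inl, Set.Nonempty]
  grind

end Interpretation

theorem statement1 (α β : Type) [LinearOrder α] [LinearOrder β] :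
    Nonempty ((Set α × Set β) ≃[Lmso] Set (Lex (α ⊕ β))) := by
  refine ⟨{ (setProdOrderIso α β).toEquiv with
    map_fun' := ?_
    map_rel' := ?_ }⟩
  · rintro (_ | n) f v
    · exact (setProdOrderIso α β).map_bot
    · exact f.elim
  · rintro (_ | _ | _ | n) r v
    · exact r.elim
    · exact atE_set.trans (((setProdOrderIso α β).isAtom_iff _).trans atE_set_prod.symm)
    · cases r
      · exact exleE_setProdOrderIso
      · exact (setProdOrderIso α β).map_rel_iff
    · exact r.elim

end MSO
end

section
/- Let M₁, M₂, N₁, N₂ be models of T_base and let k ∈ ℕ. If M₁ ≈_k N₁ and M₂ ≈_k N₂, then M₁ ⊗ M₂ ≈_k N₁ ⊗ N₂. -/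
open FirstOrder FirstOrder.Language

namespace MSO

/-! ### Back-and-forth systems -/

/-- Agreement of two tuples on the unnested atomic formulas. -/
structure AtomicAgree {M N : Type*} [Lmso.Structure M] [Lmso.Structure N] {n : ℕ}
    (a : Fin n → M) (b : Fin n → N) : Prop where
  eq_iff : ∀ i j, a i = a j ↔ b i = b j
  bot_iff : ∀ i, a i = botE M ↔ b i = botE N
  at_iff : ∀ i, atE (a i) ↔ atE (b i)
  sub_iff : ∀ i j, subE (a i) (a j) ↔ subE (b i) (b j)
  exle_iff : ∀ i j, exleE (a i) (a j) ↔ exleE (b i) (b j)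

/-- Player II wins the unnested Ehrenfeucht game of length `k` from the position `(a, b)`. -/
def BackForth {M N : Type*} [Lmso.Structure M] [Lmso.Structure N] :
    ∀ (_ : ℕ) {n : ℕ}, (Fin n → M) → (Fin n → N) → Prop
  | 0, _, a, b => AtomicAgree a b
  | k + 1, _, a, b =>
      (∀ c, ∃ d, BackForth k (Fin.snoc a c : Fin (_ + 1) → M) (Fin.snoc b d : Fin (_ + 1) → N)) ∧
      (∀ d, ∃ c, BackForth k (Fin.snoc a c : Fin (_ + 1) → M) (Fin.snoc b d : Fin (_ + 1) → N))

theorem AtomicAgree.of_snoc {M N : Type*} [Lmso.Structure M] [Lmso.Structure N] {n : ℕ}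
    {a : Fin n → M} {b : Fin n → N} {c : M} {d : N}
    (h : AtomicAgree (Fin.snoc a c : Fin (n + 1) → M) (Fin.snoc b d : Fin (n + 1) → N)) :
    AtomicAgree a b where
  eq_iff i j := by simpa using h.eq_iff i.castSucc j.castSucc
  bot_iff i := by simpa using h.bot_iff i.castSucc
  at_iff i := by simpa using h.at_iff i.castSucc
  sub_iff i j := by simpa using h.sub_iff i.castSucc j.castSucc
  exle_iff i j := by simpa using h.exle_iff i.castSucc j.castSucc

theorem BackForth.atomicAgree {M N : Type*} [Lmso.Structure M] [Lmso.Structure N] :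
    ∀ {k n : ℕ} {a : Fin n → M} {b : Fin n → N}, BackForth k a b → AtomicAgree a b
  | 0, _, _, _, h => h
  | _ + 1, _, _, _, h => (h.1 (botE M)).choose_spec.atomicAgree.of_snoc

theorem AtomicAgree.realize_rel_iff {M N : Type*} [Lmso.Structure M] [Lmso.Structure N] {n : ℕ}
    {a : Fin n → M} {b : Fin n → N} (h : AtomicAgree a b) :
    ∀ {l : ℕ} (R : Lmso.Relations l) (g : Fin l → Fin n),
      Structure.RelMap R (fun i => a (g i)) ↔ Structure.RelMap R (fun i => b (g i))
  | 0, R, _ => R.elim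
  | 1, (), g => by
      have e₁ : (fun i => a (g i)) = ![a (g 0)] := by ext i; fin_cases i; rfl
      have e₂ : (fun i => b (g i)) = ![b (g 0)] := by ext i; fin_cases i; rfl
      rw [e₁, e₂]
      exact h.at_iff (g 0)
  | 2, R, g => by
      have e₁ : (fun i => a (g i)) = ![a (g 0), a (g 1)] := by ext i; fin_cases i <;> rfl
      have e₂ : (fun i => b (g i)) = ![b (g 0), b (g 1)] := by ext i; fin_cases i <;> rfl
      rw [e₁, e₂]
      cases R with
      | true => exact h.sub_iff (g 0) (g 1)
      | false => exact h.exle_iff (g 0) (g 1)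
  | _ + 3, R, _ => R.elim

theorem coe_constants_eq_botE {M : Type*} [Lmso.Structure M] (c : Lmso.Constants) :
    (c : M) = botE M :=
  congrArg (Structure.funMap c) (Subsingleton.elim _ _)

theorem BackForth.realize_iff {M N : Type*} [Lmso.Structure M] [Lmso.Structure N] {n : ℕ}
    (φ : BF n) : ∀ {k : ℕ} {a : Fin n → M} {b : Fin n → N}, BackForth k a b →
      IsUnnested φ → qr φ ≤ k → (φ.Realize default a ↔ φ.Realize default b) := by
  induction φ with
  | falsum => intros; rfl
  | equal s t =>
    rintro k a b h (⟨i, j, rfl, rfl⟩ | ⟨c, j, rfl, rfl⟩) -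
    · obtain i | i := i
      · exact i.elim
      obtain j | j := j
      · exact j.elim
      exact h.atomicAgree.eq_iff i j
    · obtain j | j := j
      · exact j.elim
      simpa [BoundedFormula.Realize, coe_constants_eq_botE, eq_comm] using h.atomicAgree.bot_iff j
  | @rel n l R ts =>
    intro k a b h hu _
    have hv : ∀ i, ∃ j : Fin n, ts i = Term.var (Sum.inr j) := fun i => by
      obtain ⟨j | j, hj⟩ := hu i
      · exact j.elim
      · exact ⟨j, hj⟩
    choose g hg using hv
    simpa [BoundedFormula.Realize, hg] using h.atomicAgree.realize_rel_iff R g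
  | imp f g ihf ihg =>
    intro k a b h hu hq
    have hq' : qr f ≤ k ∧ qr g ≤ k := max_le_iff.1 hq
    exact imp_congr (ihf h hu.1 hq'.1) (ihg h hu.2 hq'.2)
  | all f ih =>
    intro k a b h hu hq
    obtain _ | k := k
    · exact absurd hq (Nat.not_succ_le_zero _)
    have hq' : qr f ≤ k := Nat.le_of_succ_le_succ hq
    constructor
    · intro H d
      obtain ⟨c, hc⟩ := h.2 d
      exact (ih hc hu hq').1 (H c)
    · intro H c
      obtain ⟨d, hd⟩ := h.1 c
      exact (ih hd hu hq').2 (H d)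

/-! ### Hintikka formulas -/

/-- The unnested atomic formulas in `n` variables. -/
def atomicList (n : ℕ) : List (BF n) :=
  (List.finRange n).flatMap fun i =>
    [at' i, Term.bdEqual tb (tv i)] ++
      (List.finRange n).flatMap fun j => [eq' i j, sub' i j, exle' i j]

/-- All conjunctions choosing, for each formula of a list, either the formula or its negation. -/
def signedConjs {n : ℕ} : List (BF n) → List (BF n)
  | [] => [⊤]
  | φ :: l => (signedConjs l).flatMap fun ψ => [φ ⊓ ψ, ∼φ ⊓ ψ]

/-- Formulas of rank `k` in `n` variables deciding the Ehrenfeucht game of length `k`. -/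
def hintikkaList : ∀ _ n : ℕ, List (BF n)
  | 0, n => atomicList n
  | k + 1, n => (signedConjs (hintikkaList k (n + 1))).map fun φ => ∃' φ

theorem signedConjs_unnested {n k : ℕ} : ∀ (l : List (BF n)),
    (∀ φ ∈ l, IsUnnested φ ∧ qr φ ≤ k) → ∀ φ ∈ signedConjs l, IsUnnested φ ∧ qr φ ≤ k
  | [], _ => by
      intro φ hφ
      obtain rfl := List.mem_singleton.1 hφ
      exact ⟨⟨trivial, trivial⟩, Nat.zero_le _⟩
  | χ :: l, h => by
      intro φ hφ
      obtain ⟨ψ, hψ, hφ⟩ := List.mem_flatMap.1 hφ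
      obtain ⟨hψu, hψq⟩ := signedConjs_unnested l (fun φ hφ => h φ (List.mem_cons_of_mem _ hφ)) ψ hψ
      obtain ⟨hχu, hχq⟩ := h χ List.mem_cons_self
      have hz : ∀ m, qr (BoundedFormula.falsum : BF m) = 0 := fun _ => rfl
      simp only [List.mem_cons, List.not_mem_nil, or_false] at hφ
      obtain rfl | rfl := hφ
      · exact ⟨⟨⟨hχu, hψu, trivial⟩, trivial⟩,
          max_le (max_le hχq (max_le hψq (Nat.zero_le _))) (Nat.zero_le _)⟩
      · exact ⟨⟨⟨⟨hχu, trivial⟩, hψu, trivial⟩, trivial⟩,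
          max_le (max_le (max_le hχq (Nat.zero_le _)) (max_le hψq (Nat.zero_le _)))
            (Nat.zero_le _)⟩

theorem exists_mem_signedConjs_realize {M : Type*} [Lmso.Structure M] {n : ℕ} (a : Fin n → M) :
    ∀ l : List (BF n), ∃ ψ ∈ signedConjs l, ψ.Realize default a
  | [] => ⟨⊤, List.mem_singleton.2 rfl, by simp⟩
  | φ :: l => by
      obtain ⟨ψ, hψ, ha⟩ := exists_mem_signedConjs_realize a l
      by_cases h : φ.Realize default a
      · exact ⟨φ ⊓ ψ, List.mem_flatMap.2 ⟨ψ, hψ, by simp⟩, by simp [h, ha]⟩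
      · exact ⟨∼φ ⊓ ψ, List.mem_flatMap.2 ⟨ψ, hψ, by simp⟩, by simp [h, ha]⟩

theorem agree_of_mem_signedConjs {M N : Type*} [Lmso.Structure M] [Lmso.Structure N] {n : ℕ}
    {a : Fin n → M} {b : Fin n → N} : ∀ {l : List (BF n)} {ψ : BF n}, ψ ∈ signedConjs l →
      ψ.Realize default a → ψ.Realize default b →
      ∀ φ ∈ l, (φ.Realize default a ↔ φ.Realize default b)
  | [], _, _, _, _ => by simp
  | χ :: l, ψ, hψ, ha, hb => by
      obtain ⟨θ, hθ, h⟩ := List.mem_flatMap.1 hψ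
      simp only [List.mem_cons, List.not_mem_nil, or_false] at h
      intro φ hφ
      rcases h with rfl | rfl <;>
        simp only [BoundedFormula.realize_inf, BoundedFormula.realize_not] at ha hb <;>
        obtain rfl | hφ := List.mem_cons.1 hφ
      · exact iff_of_true ha.1 hb.1
      · exact agree_of_mem_signedConjs hθ ha.2 hb.2 φ hφ
      · exact iff_of_false ha.1 hb.1
      · exact agree_of_mem_signedConjs hθ ha.2 hb.2 φ hφ

theorem mem_atomicList {n : ℕ} {φ : BF n} : φ ∈ atomicList n ↔
    ∃ i, (φ = at' i ∨ φ = Term.bdEqual tb (tv i)) ∨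
      ∃ j, φ = eq' i j ∨ φ = sub' i j ∨ φ = exle' i j := by
  simp only [atomicList, List.mem_flatMap, List.mem_append, List.mem_cons, List.not_mem_nil,
    or_false, List.mem_finRange, true_and]

theorem atomicList_unnested {n : ℕ} : ∀ φ ∈ atomicList n, IsUnnested φ ∧ qr φ ≤ 0 := by
  intro φ hφ
  have hrel : ∀ {l : ℕ} (R : Lmso.Relations l) (ts : Fin l → Lmso.Term (Empty ⊕ Fin n)),
      (∀ i, ∃ j, ts i = Term.var j) →
      IsUnnested (BoundedFormula.rel R ts : BF n) ∧ qr (BoundedFormula.rel R ts : BF n) ≤ 0 :=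
    fun _ _ h => ⟨h, le_rfl⟩
  obtain ⟨i, (rfl | rfl) | ⟨j, rfl | rfl | rfl⟩⟩ := mem_atomicList.1 hφ
  · exact hrel _ _ fun x => ⟨Sum.inr i, by fin_cases x; rfl⟩
  · exact ⟨Or.inr ⟨botC, Sum.inr i, rfl, rfl⟩, le_rfl⟩
  · exact ⟨Or.inl ⟨Sum.inr i, Sum.inr j, rfl, rfl⟩, le_rfl⟩
  · refine hrel _ _ fun x => ?_
    fin_cases x
    exacts [⟨Sum.inr i, rfl⟩, ⟨Sum.inr j, rfl⟩]
  · refine hrel _ _ fun x => ?_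
    fin_cases x
    exacts [⟨Sum.inr i, rfl⟩, ⟨Sum.inr j, rfl⟩]

theorem hintikkaList_unnested : ∀ {k n : ℕ}, ∀ φ ∈ hintikkaList k n, IsUnnested φ ∧ qr φ ≤ k
  | 0, _ => atomicList_unnested
  | k + 1, n => by
      intro φ hφ
      obtain ⟨ψ, hψ, rfl⟩ := List.mem_map.1 hφ
      obtain ⟨hu, hq⟩ := signedConjs_unnested _ (hintikkaList_unnested (k := k)) ψ hψ
      exact ⟨⟨⟨hu, trivial⟩, trivial⟩,
        max_le (Nat.succ_le_succ (max_le hq (Nat.zero_le _))) (Nat.zero_le _)⟩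

section realize

variable {M : Type*} [Lmso.Structure M] {n : ℕ} (v : Empty → M) (a : Fin n → M) (i j : Fin n)

theorem realize_at' : (at' i).Realize v a ↔ atE (a i) := by
  simp [at', atE, tv, BoundedFormula.realize_rel₁]

theorem realize_sub' : (sub' i j).Realize v a ↔ subE (a i) (a j) := by
  simp [sub', subE, tv, BoundedFormula.realize_rel₂]

theorem realize_exle' : (exle' i j).Realize v a ↔ exleE (a i) (a j) := by
  simp [exle', exleE, tv, BoundedFormula.realize_rel₂]

theorem realize_eq' : (eq' i j).Realize v a ↔ a i = a j := by
  simp [eq', tv]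

theorem realize_isBot' : (isBot' i).Realize v a ↔ a i = botE M := by
  simp [isBot', tv, tb, coe_constants_eq_botE]

theorem realize_bot_eq :
    (Term.bdEqual tb (tv i) : BF n).Realize v a ↔ a i = botE M := by
  simp [tv, tb, coe_constants_eq_botE, eq_comm]

theorem realize_botSub' : (botSub' i).Realize v a ↔ subE (botE M) (a i) := by
  simp [botSub', subE, tv, tb, BoundedFormula.realize_rel₂, coe_constants_eq_botE]

theorem realize_isAtomDef : (isAtomDef i).Realize v a ↔
    a i ≠ botE M ∧ ∀ q, subE q (a i) → q = botE M ∨ q = a i := by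
  simp [isAtomDef, realize_isBot', realize_sub', realize_eq']

end realize

theorem BackForth.of_agree {M N : Type*} [Lmso.Structure M] [Lmso.Structure N] :
    ∀ {k n : ℕ} {a : Fin n → M} {b : Fin n → N},
      (∀ φ ∈ hintikkaList k n, (φ.Realize default a ↔ φ.Realize default b)) → BackForth k a b
  | 0, n, a, b, h => by
      have h' : ∀ φ ∈ atomicList n, (φ.Realize default a ↔ φ.Realize default b) := h
      refine ⟨fun i j => ?_, fun i => ?_, fun i => ?_, fun i j => ?_, fun i j => ?_⟩
      · simpa only [realize_eq'] using h' (eq' i j) (mem_atomicList.2 ⟨i, Or.inr ⟨j, by simp⟩⟩)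
      · simpa only [realize_bot_eq] using h' (Term.bdEqual tb (tv i)) (mem_atomicList.2 ⟨i, by simp⟩)
      · simpa only [realize_at'] using h' (at' i) (mem_atomicList.2 ⟨i, by simp⟩)
      · simpa only [realize_sub'] using h' (sub' i j) (mem_atomicList.2 ⟨i, Or.inr ⟨j, by simp⟩⟩)
      · simpa only [realize_exle'] using h' (exle' i j) (mem_atomicList.2 ⟨i, Or.inr ⟨j, by simp⟩⟩)
  | k + 1, n, a, b, h => by
      constructor
      · intro c
        obtain ⟨ψ, hψ, hc⟩ := exists_mem_signedConjs_realize (Fin.snoc a c : Fin (n + 1) → M)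
          (hintikkaList k (n + 1))
        obtain ⟨d, hd⟩ := BoundedFormula.realize_ex.1
          ((h _ (List.mem_map.2 ⟨ψ, hψ, rfl⟩)).1 (BoundedFormula.realize_ex.2 ⟨c, hc⟩))
        exact ⟨d, BackForth.of_agree (agree_of_mem_signedConjs hψ hc hd)⟩
      · intro d
        obtain ⟨ψ, hψ, hd⟩ := exists_mem_signedConjs_realize (Fin.snoc b d : Fin (n + 1) → N)
          (hintikkaList k (n + 1))
        obtain ⟨c, hc⟩ := BoundedFormula.realize_ex.1
          ((h _ (List.mem_map.2 ⟨ψ, hψ, rfl⟩)).2 (BoundedFormula.realize_ex.2 ⟨d, hd⟩))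
        exact ⟨c, BackForth.of_agree (agree_of_mem_signedConjs hψ hc hd)⟩

theorem equivK_iff_backForth {M N : Type*} [Lmso.Structure M] [Lmso.Structure N] {k : ℕ} :
    EquivK k M N ↔ BackForth k (default : Fin 0 → M) (default : Fin 0 → N) :=
  ⟨fun h => .of_agree fun φ hφ =>
      h φ (hintikkaList_unnested φ hφ).1 (hintikkaList_unnested φ hφ).2,
    fun h φ hu hq => h.realize_iff φ hu hq⟩

/-! ### Atoms of the product -/

section atoms

variable {M N : Type*} [Lmso.Structure M] [Lmso.Structure N]

theorem subE_refl_of_model (h : M ⊨ Tbase) (x : M) : subE x x := by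
  have := h.realize_of_mem axRefl (by simp [Tbase])
  simp only [axRefl, Sentence.Realize, Formula.Realize, BoundedFormula.realize_all,
    realize_sub'] at this
  exact this x

theorem botE_subE_of_model (h : M ⊨ Tbase) (x : M) : subE (botE M) x := by
  have := h.realize_of_mem axBotLe (by simp [Tbase])
  simp only [axBotLe, Sentence.Realize, Formula.Realize, BoundedFormula.realize_all,
    realize_botSub'] at this
  exact this x

theorem subE_antisymm_of_model (h : M ⊨ Tbase) {x y : M} (hxy : subE x y) (hyx : subE y x) :
    x = y := by
  have := h.realize_of_mem axAntisymm (by simp [Tbase])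
  simp only [axAntisymm, Sentence.Realize, Formula.Realize, BoundedFormula.realize_all,
    BoundedFormula.realize_imp, BoundedFormula.realize_inf, realize_sub', realize_eq'] at this
  exact this x y ⟨hxy, hyx⟩

theorem atE_iff_of_model (h : M ⊨ Tbase) (x : M) :
    atE x ↔ x ≠ botE M ∧ ∀ q, subE q x → q = botE M ∨ q = x := by
  have := h.realize_of_mem axAt (by simp [Tbase])
  simp only [axAt, Sentence.Realize, Formula.Realize, BoundedFormula.realize_all,
    BoundedFormula.realize_iff, realize_at', realize_isAtomDef] at this
  exact this x

theorem atE_prod_iff (hM : M ⊨ Tbase) (hN : N ⊨ Tbase) (p : M × N) :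
    atE p ↔ (atE p.1 ∧ p.2 = botE N) ∨ (p.1 = botE M ∧ atE p.2) := by
  obtain ⟨x, y⟩ := p
  have hdef : atE (x, y) ↔ (x, y) ≠ (botE M, botE N) ∧
      ∀ q : M × N, subE q.1 x → subE q.2 y → q = (botE M, botE N) ∨ q = (x, y) := Iff.rfl
  rw [hdef]
  simp only [atE_iff_of_model hM, atE_iff_of_model hN]
  constructor
  · rintro ⟨hne, hmin⟩
    have hbot := hmin (x, botE N) (subE_refl_of_model hM x) (botE_subE_of_model hN y)
    simp only [Prod.mk.injEq, and_true, true_and] at hbot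
    rcases hbot with rfl | rfl
    · refine Or.inr ⟨rfl, fun h => hne (by rw [h]), fun q hq => ?_⟩
      simpa using hmin (botE M, q) (subE_refl_of_model hM _) hq
    · refine Or.inl ⟨⟨fun h => hne (by rw [h]), fun q hq => ?_⟩, rfl⟩
      simpa using hmin (q, botE N) hq (subE_refl_of_model hN _)
  · rintro (⟨⟨hne, hmin⟩, rfl⟩ | ⟨rfl, hne, hmin⟩)
    · refine ⟨fun h => hne (Prod.mk.inj h).1, fun ⟨q₁, q₂⟩ h₁ h₂ => ?_⟩
      have e : q₂ = botE N := subE_antisymm_of_model hN h₂ (botE_subE_of_model hN _)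
      simpa [e] using hmin q₁ h₁
    · refine ⟨fun h => hne (Prod.mk.inj h).2, fun ⟨q₁, q₂⟩ h₁ h₂ => ?_⟩
      have e : q₁ = botE M := subE_antisymm_of_model hM h₁ (botE_subE_of_model hM _)
      simpa [e] using hmin q₂ h₂

end atoms

theorem AtomicAgree.prod {M₁ M₂ N₁ N₂ : Type*} [Lmso.Structure M₁] [Lmso.Structure M₂]
    [Lmso.Structure N₁] [Lmso.Structure N₂]
    (hM₁ : M₁ ⊨ Tbase) (hM₂ : M₂ ⊨ Tbase) (hN₁ : N₁ ⊨ Tbase) (hN₂ : N₂ ⊨ Tbase) {n : ℕ}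
    {a₁ : Fin n → M₁} {a₂ : Fin n → M₂} {b₁ : Fin n → N₁} {b₂ : Fin n → N₂}
    (h₁ : AtomicAgree a₁ b₁) (h₂ : AtomicAgree a₂ b₂) :
    AtomicAgree (fun i => (a₁ i, a₂ i)) (fun i => (b₁ i, b₂ i)) where
  eq_iff i j := by simp [h₁.eq_iff, h₂.eq_iff]
  bot_iff i := by
    change (_, _) = (botE M₁, botE M₂) ↔ (_, _) = (botE N₁, botE N₂)
    simp [h₁.bot_iff, h₂.bot_iff]
  at_iff i := by
    simp [atE_prod_iff hM₁ hM₂, atE_prod_iff hN₁ hN₂, h₁.bot_iff, h₂.bot_iff, h₁.at_iff, h₂.at_iff]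
  sub_iff i j := and_congr (h₁.sub_iff i j) (h₂.sub_iff i j)
  exle_iff i j := or_congr (and_congr (not_congr (h₁.bot_iff i)) (not_congr (h₂.bot_iff j)))
    (or_congr (h₁.exle_iff i j) (h₂.exle_iff i j))

theorem snoc_prodMk {α β : Type*} {n : ℕ} (a : Fin n → α) (b : Fin n → β) (c : α × β) :
    (Fin.snoc (fun i => (a i, b i)) c : Fin (n + 1) → α × β) =
      fun i => ((Fin.snoc a c.1 : Fin (n + 1) → α) i, (Fin.snoc b c.2 : Fin (n + 1) → β) i) := by
  ext i <;> refine Fin.lastCases ?_ (fun i => ?_) i <;> simp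

theorem BackForth.prod {M₁ M₂ N₁ N₂ : Type*} [Lmso.Structure M₁] [Lmso.Structure M₂]
    [Lmso.Structure N₁] [Lmso.Structure N₂]
    (hM₁ : M₁ ⊨ Tbase) (hM₂ : M₂ ⊨ Tbase) (hN₁ : N₁ ⊨ Tbase) (hN₂ : N₂ ⊨ Tbase) :
    ∀ {k n : ℕ} {a₁ : Fin n → M₁} {a₂ : Fin n → M₂} {b₁ : Fin n → N₁} {b₂ : Fin n → N₂},
      BackForth k a₁ b₁ → BackForth k a₂ b₂ →
      BackForth k (fun i => (a₁ i, a₂ i)) (fun i => (b₁ i, b₂ i))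
  | 0, _, _, _, _, _, h₁, h₂ => AtomicAgree.prod hM₁ hM₂ hN₁ hN₂ h₁ h₂
  | k + 1, _, _, _, _, _, h₁, h₂ => by
      constructor
      · intro c
        obtain ⟨d₁, hd₁⟩ := h₁.1 c.1
        obtain ⟨d₂, hd₂⟩ := h₂.1 c.2
        refine ⟨(d₁, d₂), ?_⟩
        simp only [snoc_prodMk]
        exact BackForth.prod hM₁ hM₂ hN₁ hN₂ hd₁ hd₂
      · intro d
        obtain ⟨c₁, hc₁⟩ := h₁.2 d.1
        obtain ⟨c₂, hc₂⟩ := h₂.2 d.2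
        refine ⟨(c₁, c₂), ?_⟩
        simp only [snoc_prodMk]
        exact BackForth.prod hM₁ hM₂ hN₁ hN₂ hc₁ hc₂

theorem statement2 (M₁ M₂ N₁ N₂ : Type) [Lmso.Structure M₁] [Lmso.Structure M₂]
    [Lmso.Structure N₁] [Lmso.Structure N₂]
    (hM₁ : M₁ ⊨ Tbase) (hM₂ : M₂ ⊨ Tbase) (hN₁ : N₁ ⊨ Tbase) (hN₂ : N₂ ⊨ Tbase)
    (k : ℕ) (h₁ : EquivK k M₁ N₁) (h₂ : EquivK k M₂ N₂) :
    EquivK k (M₁ × M₂) (N₁ × N₂) := by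
  rw [equivK_iff_backForth] at h₁ h₂ ⊢
  convert BackForth.prod hM₁ hM₂ hN₁ hN₂ h₁ h₂ using 1

end MSO
end

section
/- Let M₁, M₂, N₁, N₂ be models of T_base. If M₁ is elementarily equivalent to N₁ and M₂ is elementarily equivalent to N₂, then M₁ ⊗ M₂ is elementarily equivalent to N₁ ⊗ N₂. -/
open FirstOrder FirstOrder.Language

namespace MSO

/-- A property of a pair of `n`-tuples, uniform in the pair of structures the tuples live in, is
decomposable if it is a finite disjunction of conjunctions `α(a) ∧ β(b)`, with `α` a formula about
the first tuple and `β` a formula about the second. -/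
def IsDecomposable {n : ℕ} (P : ∀ (M N : Type) [Lmso.Structure M] [Lmso.Structure N],
    (Fin n → M) → (Fin n → N) → Prop) : Prop :=
  ∃ l : List (BF n × BF n), ∀ (M N : Type) [Lmso.Structure M] [Lmso.Structure N]
    (a : Fin n → M) (b : Fin n → N),
    P M N a b ↔ ∃ p ∈ l, p.1.Realize default a ∧ p.2.Realize default b

namespace IsDecomposable

variable {n : ℕ} {P Q : ∀ (M N : Type) [Lmso.Structure M] [Lmso.Structure N],
    (Fin n → M) → (Fin n → N) → Prop}

theorem congr (hP : IsDecomposable P)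
    (h : ∀ (M N : Type) [Lmso.Structure M] [Lmso.Structure N] (a : Fin n → M) (b : Fin n → N),
      Q M N a b ↔ P M N a b) : IsDecomposable Q := by
  obtain ⟨l, hl⟩ := hP
  exact ⟨l, fun M N _ _ a b => (h M N a b).trans (hl M N a b)⟩

theorem of_left (φ : BF n) : IsDecomposable fun _ _ _ _ a _ => φ.Realize default a :=
  ⟨[(φ, ⊤)], fun M N _ _ a b => by simp⟩

theorem of_right (φ : BF n) : IsDecomposable fun _ _ _ _ _ b => φ.Realize default b :=
  ⟨[(⊤, φ)], fun M N _ _ a b => by simp⟩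

theorem or (hP : IsDecomposable P) (hQ : IsDecomposable Q) :
    IsDecomposable fun M N _ _ a b => P M N a b ∨ Q M N a b := by
  obtain ⟨l, hl⟩ := hP
  obtain ⟨m, hm⟩ := hQ
  refine ⟨l ++ m, fun M N _ _ a b => ?_⟩
  simp only [hl, hm, List.mem_append, or_and_right, exists_or]

theorem and (hP : IsDecomposable P) (hQ : IsDecomposable Q) :
    IsDecomposable fun M N _ _ a b => P M N a b ∧ Q M N a b := by
  obtain ⟨l, hl⟩ := hP
  obtain ⟨m, hm⟩ := hQ
  refine ⟨(l.product m).map fun r => (r.1.1 ⊓ r.2.1, r.1.2 ⊓ r.2.2), fun M N _ _ a b => ?_⟩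
  simp only [hl, hm, List.mem_map, Prod.exists]
  constructor
  · rintro ⟨⟨α, β, h, hα, hβ⟩, γ, δ, h', hγ, hδ⟩
    exact ⟨_, _, ⟨α, β, γ, δ, List.pair_mem_product.2 ⟨h, h'⟩, rfl⟩, by simp [*], by simp [*]⟩
  · rintro ⟨_, _, ⟨α, β, γ, δ, hmem, ⟨⟩⟩, h₁, h₂⟩
    obtain ⟨h, h'⟩ := List.pair_mem_product.1 hmem
    rw [BoundedFormula.realize_inf] at h₁ h₂
    exact ⟨⟨α, β, h, h₁.1, h₂.1⟩, γ, δ, h', h₁.2, h₂.2⟩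

theorem not (hP : IsDecomposable P) : IsDecomposable fun M N _ _ a b => ¬ P M N a b := by
  obtain ⟨l, hl⟩ := hP
  induction l generalizing P with
  | nil => exact (of_left ⊤).congr fun M N _ _ a b => by simp [hl]
  | cons p l ih =>
    refine (((of_left p.1.not).or (of_right p.2.not)).and
      (ih (P := fun M N _ _ a b => ∃ p ∈ l, p.1.Realize default a ∧ p.2.Realize default b)
        fun M N _ _ a b => Iff.rfl)).congr fun M N _ _ a b => ?_
    rw [hl, List.exists_mem_cons_iff, not_or, not_and_or, BoundedFormula.realize_not,
      BoundedFormula.realize_not]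

theorem imp (hP : IsDecomposable P) (hQ : IsDecomposable Q) :
    IsDecomposable fun M N _ _ a b => P M N a b → Q M N a b :=
  (hP.not.or hQ).congr fun _ _ _ _ _ _ => imp_iff_not_or

theorem ex {R : ∀ (M N : Type) [Lmso.Structure M] [Lmso.Structure N],
    (Fin (n + 1) → M) → (Fin (n + 1) → N) → Prop} (hR : IsDecomposable R) :
    IsDecomposable fun M N _ _ a b => ∃ q : M × N, R M N (Fin.snoc a q.1) (Fin.snoc b q.2) := by
  obtain ⟨l, hl⟩ := hR
  refine ⟨l.map fun p => (p.1.ex, p.2.ex), fun M N _ _ a b => ?_⟩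
  simp only [hl, List.mem_map, exists_exists_and_eq_and, BoundedFormula.realize_ex]
  constructor
  · rintro ⟨q, p, hp, h₁, h₂⟩
    exact ⟨p, hp, ⟨q.1, h₁⟩, q.2, h₂⟩
  · rintro ⟨p, hp, ⟨x, h₁⟩, y, h₂⟩
    exact ⟨(x, y), p, hp, h₁, h₂⟩

theorem all {R : ∀ (M N : Type) [Lmso.Structure M] [Lmso.Structure N],
    (Fin (n + 1) → M) → (Fin (n + 1) → N) → Prop} (hR : IsDecomposable R) :
    IsDecomposable fun M N _ _ a b => ∀ q : M × N, R M N (Fin.snoc a q.1) (Fin.snoc b q.2) :=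
  hR.not.ex.not.congr fun M N _ _ a b => by push Not; rfl

end IsDecomposable

/-- The value of a bounded term at a tuple. -/
def tval {n : ℕ} {M : Type} [Lmso.Structure M] (t : Lmso.Term (Empty ⊕ Fin n))
    (a : Fin n → M) : M :=
  t.realize (Sum.elim default a)

/-- Lifting a term to a context with one more variable. -/
def liftTerm {n : ℕ} (t : Lmso.Term (Empty ⊕ Fin n)) : Lmso.Term (Empty ⊕ Fin (n + 1)) :=
  t.relabel (Sum.map id Fin.castSucc)

section Terms

variable {n : ℕ} {M N : Type} [Lmso.Structure M] [Lmso.Structure N]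

theorem tval_liftTerm (t : Lmso.Term (Empty ⊕ Fin n)) (a : Fin n → M) (x : M) :
    tval (liftTerm t) (Fin.snoc a x) = tval t a := by
  unfold tval liftTerm
  rw [Term.realize_relabel]
  congr 1
  funext i
  rcases i with i | i
  · exact i.elim
  · simp

theorem tval_tv_last (a : Fin n → M) (x : M) :
    tval (tv (Fin.last n)) (Fin.snoc a x : Fin (n + 1) → M) = x := by
  simp [tval, tv]

theorem tval_tb (a : Fin n → M) : tval tb a = botE M := by
  exact congrArg (Structure.funMap botC) (Subsingleton.elim _ _)

theorem tval_prod (t : Lmso.Term (Empty ⊕ Fin n)) (a : Fin n → M) (b : Fin n → N) :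
    tval t (fun i => (a i, b i)) = (tval t a, tval t b) := by
  cases t with
  | var i =>
    rcases i with i | i
    · exact i.elim
    · rfl
  | @func k f ts =>
    match k, f with
    | 0, f =>
      exact congrArg₂ Prod.mk
        (congrArg (Structure.funMap (M := M) f) (Subsingleton.elim _ _))
        (congrArg (Structure.funMap (M := N) f) (Subsingleton.elim _ _))
    | _ + 1, f => exact f.elim

theorem realize_bdEqual_iff (s t : Lmso.Term (Empty ⊕ Fin n)) (a : Fin n → M) :
    (s.bdEqual t).Realize default a ↔ tval s a = tval t a :=
  BoundedFormula.realize_bdEqual s t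

theorem realize_subR_iff (s t : Lmso.Term (Empty ⊕ Fin n)) (a : Fin n → M) :
    (subR.boundedFormula₂ s t).Realize default a ↔ subE (tval s a) (tval t a) :=
  BoundedFormula.realize_rel₂

theorem realize_exleR_iff (s t : Lmso.Term (Empty ⊕ Fin n)) (a : Fin n → M) :
    (exleR.boundedFormula₂ s t).Realize default a ↔ exleE (tval s a) (tval t a) :=
  BoundedFormula.realize_rel₂

end Terms

namespace IsDecomposable

variable {n : ℕ} (s t : Lmso.Term (Empty ⊕ Fin n))

theorem eq : IsDecomposable fun M N _ _ a b =>
    ((tval s a, tval s b) : M × N) = (tval t a, tval t b) :=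
  ((of_left (s.bdEqual t)).and (of_right (s.bdEqual t))).congr fun M N _ _ a b => by
    rw [realize_bdEqual_iff, realize_bdEqual_iff, Prod.mk.injEq]

theorem subE_left : IsDecomposable fun _ _ _ _ a _ => subE (tval s a) (tval t a) :=
  (of_left (subR.boundedFormula₂ s t)).congr fun _ _ _ _ _ _ => (realize_subR_iff s t _).symm

theorem subE_right : IsDecomposable fun _ _ _ _ _ b => subE (tval s b) (tval t b) :=
  (of_right (subR.boundedFormula₂ s t)).congr fun _ _ _ _ _ _ => (realize_subR_iff s t _).symm

theorem exleE : IsDecomposable fun M N _ _ a b =>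
    (tval s a ≠ botE M ∧ tval t b ≠ botE N) ∨
      exleE (tval s a) (tval t a) ∨ exleE (tval s b) (tval t b) :=
  (((of_left (s.bdEqual tb)).not.and (of_right (t.bdEqual tb)).not).or
    ((of_left (exleR.boundedFormula₂ s t)).or (of_right (exleR.boundedFormula₂ s t)))).congr
    fun M N _ _ a b => by
      simp only [realize_bdEqual_iff, realize_exleR_iff, tval_tb, ne_eq]

theorem atE : IsDecomposable fun M N _ _ a b =>
    ((tval t a, tval t b) : M × N) ≠ (botE M, botE N) ∧
      ∀ q : M × N, subE q.1 (tval t a) → subE q.2 (tval t b) →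
        q = (botE M, botE N) ∨ q = (tval t a, tval t b) :=
  ((eq t tb).not.and ((subE_left (tv (Fin.last n)) (liftTerm t)).imp
    ((subE_right (tv (Fin.last n)) (liftTerm t)).imp
      ((eq (tv (Fin.last n)) tb).or (eq (tv (Fin.last n)) (liftTerm t))))).all).congr
    fun M N _ _ a b => by
      simp only [tval_tb, tval_liftTerm, tval_tv_last, ne_eq]

end IsDecomposable

theorem snoc_prod {n : ℕ} {M N : Type} (a : Fin n → M) (b : Fin n → N) (q : M × N) :
    (Fin.snoc (fun i => (a i, b i)) q : Fin (n + 1) → M × N) =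
      fun i => ((Fin.snoc a q.1 : Fin (n + 1) → M) i, (Fin.snoc b q.2 : Fin (n + 1) → N) i) := by
  funext i
  refine Fin.lastCases ?_ (fun i => ?_) i <;> simp

/-- The Feferman–Vaught decomposition for `⊗`. -/
theorem isDecomposable_realize {n : ℕ} (φ : BF n) : IsDecomposable fun M N _ _ a b =>
    φ.Realize (default : Empty → M × N) (fun i => (a i, b i)) := by
  induction φ with
  | falsum => exact (IsDecomposable.of_left ⊥).congr fun _ _ _ _ _ _ => Iff.rfl
  | equal s t =>
    refine (IsDecomposable.eq s t).congr fun M N _ _ a b => ?_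
    rw [← tval_prod, ← tval_prod]
    exact realize_bdEqual_iff s t _
  | @rel n k r ts =>
    match k, r with
    | 0, r => exact r.elim
    | 1, () =>
      refine (IsDecomposable.atE (ts 0)).congr fun M N _ _ a b => ?_
      change (tval (ts 0) fun i => (a i, b i)) ≠ (botE M, botE N) ∧
        (∀ q : M × N, subE q.1 (tval (ts 0) fun i => (a i, b i)).1 →
          subE q.2 (tval (ts 0) fun i => (a i, b i)).2 →
            q = (botE M, botE N) ∨ q = tval (ts 0) fun i => (a i, b i)) ↔ _
      rw [tval_prod]
    | 2, true =>
      refine ((IsDecomposable.subE_left (ts 0) (ts 1)).and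
        (IsDecomposable.subE_right (ts 0) (ts 1))).congr fun M N _ _ a b => ?_
      change subE (tval (ts 0) fun i => (a i, b i)).1 (tval (ts 1) fun i => (a i, b i)).1 ∧
        subE (tval (ts 0) fun i => (a i, b i)).2 (tval (ts 1) fun i => (a i, b i)).2 ↔ _
      rw [tval_prod, tval_prod]
    | 2, false =>
      refine (IsDecomposable.exleE (ts 0) (ts 1)).congr fun M N _ _ a b => ?_
      change ((tval (ts 0) fun i => (a i, b i)).1 ≠ botE M ∧
          (tval (ts 1) fun i => (a i, b i)).2 ≠ botE N) ∨
        exleE (tval (ts 0) fun i => (a i, b i)).1 (tval (ts 1) fun i => (a i, b i)).1 ∨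
        exleE (tval (ts 0) fun i => (a i, b i)).2 (tval (ts 1) fun i => (a i, b i)).2 ↔ _
      rw [tval_prod, tval_prod]
    | _ + 3, r => exact r.elim
  | imp φ ψ hφ hψ => exact hφ.imp hψ
  | all φ hφ =>
    refine hφ.all.congr fun M N _ _ a b => ?_
    simp only [BoundedFormula.realize_all, snoc_prod]

theorem statement3 (M₁ M₂ N₁ N₂ : Type) [Lmso.Structure M₁] [Lmso.Structure M₂]
    [Lmso.Structure N₁] [Lmso.Structure N₂]
    (hM₁ : M₁ ⊨ Tbase) (hM₂ : M₂ ⊨ Tbase) (hN₁ : N₁ ⊨ Tbase) (hN₂ : N₂ ⊨ Tbase)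
    (h₁ : M₁ ≅[Lmso] N₁) (h₂ : M₂ ≅[Lmso] N₂) :
    (M₁ × M₂) ≅[Lmso] (N₁ × N₂) := by
  rw [elementarilyEquivalent_iff] at h₁ h₂ ⊢
  intro φ
  obtain ⟨l, hl⟩ := isDecomposable_realize φ
  have key : ∀ (M N : Type) [Lmso.Structure M] [Lmso.Structure N],
      (M × N) ⊨ φ ↔ ∃ p ∈ l, M ⊨ p.1 ∧ N ⊨ p.2 := fun M N _ _ =>
    Iff.trans (iff_of_eq (congrArg (BoundedFormula.Realize φ default) (Subsingleton.elim _ _)))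
      (hl M N default default)
  rw [key, key]
  exact exists_congr fun p => and_congr_right fun _ => and_congr (h₁ p.1) (h₂ p.2)

end MSO
end
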